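/- Let n ≥ 2, p ∈ ℂ, r > 0, and let y_1, …, y_{n−1}, f, g be functions analytic on the open disc B(p, r), with g(p) = 0. Let L be an analytic function on a slit disc B(p,r) ∖ ℓ, where ℓ is a ray emanating from p, satisfying L′(z) = 1/(z − p) (a branch of log(z − p)), and set y_n = f + g·L on the slit disc. Then the function (z − p)^{n−2} · ( W(y_1, …, y_{n−1}, y_n) − L·W(y_1, …, y_{n−1}, g) ), a priori defined on the slit disc, extends to a function analytic on all of B(p, r). In particular, the Wronskian W(y_1, …, y_n) differs from L·W(y_1, …, y_{n−1}, g) by a single-valued function on the punctured disc having a pole of order at most n−2 at p. -/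

import Mathlib

open scoped BigOperators

/-- The Wronskian determinant `W(z₁, …, z_m)(t) = det(z_j^{(k)}(t))`. -/
noncomputable def wronskian {m : ℕ} (z : Fin m → ℂ → ℂ) : ℂ → ℂ :=
  fun t => (Matrix.of fun k j : Fin m => iteratedDeriv (k : ℕ) (z j) t).det

theorem isClosed_complex_ray (p v : ℂ) (hv : v ≠ 0) :
    IsClosed {z : ℂ | ∃ s : ℝ, 0 ≤ s ∧ z = p + (s : ℂ) * v} := by
  have h : {z : ℂ | ∃ s : ℝ, 0 ≤ s ∧ z = p + (s : ℂ) * v} =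
      {z : ℂ | 0 ≤ ((z - p) / v).re} ∩ {z : ℂ | ((z - p) / v).im = 0} := by
    ext z
    constructor
    · rintro ⟨s, hs, rfl⟩
      simp [hv, hs]
    · rintro ⟨h1, h2⟩
      refine ⟨_, h1, ?_⟩
      have h3 : ((((z - p) / v).re : ℝ) : ℂ) = (z - p) / v :=
        Complex.ext (by simp) (by simpa using h2.symm)
      rw [h3]
      field_simp
      ring
  rw [h]
  have hc : Continuous fun z : ℂ => (z - p) / v := by fun_prop
  exact (isClosed_le continuous_const (Complex.continuous_re.comp hc)).inter
    (isClosed_eq (Complex.continuous_im.comp hc) continuous_const)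

/-- An analytic function on an open set vanishing at `p` is divisible by `z - p`. -/
theorem AnalyticOnNhd.exists_eq_sub_mul {U : Set ℂ} (hU : IsOpen U) {p : ℂ} (hp : p ∈ U)
    {g : ℂ → ℂ} (hg : AnalyticOnNhd ℂ g U) (hg0 : g p = 0) :
    ∃ q : ℂ → ℂ, AnalyticOnNhd ℂ q U ∧ ∀ z, g z = (z - p) * q z := by
  refine ⟨dslope g p, ?_, fun z => ?_⟩
  · exact ((Complex.differentiableOn_dslope (hU.mem_nhds hp)).2
      hg.differentiableOn).analyticOnNhd hU
  · simpa [hg0] using (sub_smul_dslope g p z).symm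

/-- Derivatives of `f + g * L`, where `L` is a branch of `log (z - p)` on `S` and `g p = 0`: the
part free of `L` has a pole of order at most `k` in the derivative of order `k + 1`. -/
theorem iteratedDeriv_succ_add_mul_log {U S : Set ℂ} (hU : IsOpen U) (hS : IsOpen S) (hSU : S ⊆ U)
    {p : ℂ} (hp : p ∈ U) (hpS : p ∉ S) {f g L w : ℂ → ℂ}
    (hf : AnalyticOnNhd ℂ f U) (hg : AnalyticOnNhd ℂ g U) (hg0 : g p = 0)
    (hL : ∀ z ∈ S, HasDerivAt L (1 / (z - p)) z)
    (hw : ∀ z ∈ S, w z = f z + g z * L z) (k : ℕ) :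
    ∃ h : ℂ → ℂ, AnalyticOnNhd ℂ h U ∧ ∀ z ∈ S,
      iteratedDeriv (k + 1) w z = L z * iteratedDeriv (k + 1) g z + h z / (z - p) ^ k := by
  have hne : ∀ z ∈ S, z - p ≠ 0 := fun z hz => sub_ne_zero.2 fun h => hpS (h ▸ hz)
  induction k with
  | zero =>
    obtain ⟨q, hq, hgq⟩ := hg.exists_eq_sub_mul hU hp hg0
    refine ⟨fun z => deriv f z + q z, hf.deriv.add hq, fun z hz => ?_⟩
    have h0 := hne z hz
    have hd := ((hf z (hSU hz)).differentiableAt.hasDerivAt.add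
      ((hg z (hSU hz)).differentiableAt.hasDerivAt.mul (hL z hz)))
    have he : w =ᶠ[nhds z] f + g * L :=
      Filter.eventuallyEq_of_mem (hS.mem_nhds hz) hw
    rw [zero_add, iteratedDeriv_one, iteratedDeriv_one, he.deriv_eq, hd.deriv, hgq z]
    field_simp
    ring
  | succ k ih =>
    obtain ⟨h, hh, hk⟩ := ih
    have hgk : AnalyticOnNhd ℂ (iteratedDeriv (k + 1) g) U := by
      rw [iteratedDeriv_eq_iterate]; exact hg.iterated_deriv _
    refine ⟨fun z => (z - p) ^ k * iteratedDeriv (k + 1) g z + (z - p) * deriv h z - k * h z,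
      ?_, fun z hz => ?_⟩
    · have hid : AnalyticOnNhd ℂ (fun z => z - p) U := analyticOnNhd_id.sub analyticOnNhd_const
      exact (((hid.pow k).mul hgk).add (hid.mul hh.deriv)).sub (analyticOnNhd_const.mul hh)
    have h0 := hne z hz
    have hpow : HasDerivAt (fun z => (z - p) ^ k) (k * (z - p) ^ (k - 1) * 1) z :=
      ((hasDerivAt_id z).sub_const p).pow k
    have hd := ((hL z hz).mul (hgk z (hSU hz)).differentiableAt.hasDerivAt).add
      ((hh z (hSU hz)).differentiableAt.hasDerivAt.div hpow (pow_ne_zero k h0))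
    have he : iteratedDeriv (k + 1) w =ᶠ[nhds z]
        L * iteratedDeriv (k + 1) g + h / fun z => (z - p) ^ k :=
      Filter.eventuallyEq_of_mem (hS.mem_nhds hz) hk
    rw [iteratedDeriv_succ, he.deriv_eq, hd.deriv, iteratedDeriv_succ (n := k + 1) (f := g)]
    rcases k with _ | k
    · simp
      field_simp
      ring
    · simp only [Nat.add_sub_cancel]
      field_simp
      ring

theorem AnalyticOnNhd.matrix_det {m : ℕ} {U : Set ℂ} {A : ℂ → Matrix (Fin m) (Fin m) ℂ}
    (hA : ∀ i j, AnalyticOnNhd ℂ (fun z => A z i j) U) :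
    AnalyticOnNhd ℂ (fun z => (A z).det) U := by
  simp only [Matrix.det_apply']
  exact Finset.analyticOnNhd_fun_sum _ fun σ _ => analyticOnNhd_const.mul
    (Finset.analyticOnNhd_fun_prod _ fun i _ => hA _ _)

/-- The Wronskian as a function of its last column. -/
theorem wronskian_snoc {m : ℕ} (y : Fin m → ℂ → ℂ) (w : ℂ → ℂ) (z : ℂ) :
    wronskian (Fin.snoc (α := fun _ => ℂ → ℂ) y w) z =
      (Matrix.updateCol
        (Matrix.of fun k j : Fin (m + 1) =>
          iteratedDeriv (k : ℕ) (Fin.snoc (α := fun _ => ℂ → ℂ) y 0 j) z)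
        (Fin.last m) fun k => iteratedDeriv (k : ℕ) w z).det := by
  unfold wronskian
  congr 1
  ext k j
  refine Fin.lastCases ?_ (fun j => ?_) j
  · simp
  · simp [Fin.castSucc_ne_last]

/-- let `y₁, …, y_{n−1}, f, g` be analytic on `B(p,r)` with `g(p) = 0`, let
`L` be a branch of `log(z−p)` on a slit disc (analytic off a ray `ℓ` from `p`, with
`L′(z) = 1/(z−p)`), and `y_n = f + g·L` there. Then
`(z−p)^{n−2}·(W(y₁,…,y_{n−1},y_n) − L·W(y₁,…,y_{n−1},g))` extends analytically to all of
`B(p,r)`; in particular `W(y₁,…,y_n)` differs from `L·W(y₁,…,y_{n−1},g)` by a single-valued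
function with a pole of order at most `n−2` at `p`. -/
theorem wronskian_log_structure
    (n : ℕ) (hn : 2 ≤ n) (p : ℂ) (r : ℝ) (hr : 0 < r)
    (y : Fin (n - 1) → ℂ → ℂ) (f g L : ℂ → ℂ)
    (hy : ∀ j, AnalyticOnNhd ℂ (y j) (Metric.ball p r))
    (hf : AnalyticOnNhd ℂ f (Metric.ball p r))
    (hg : AnalyticOnNhd ℂ g (Metric.ball p r)) (hg0 : g p = 0)
    (v : ℂ) (hv : v ≠ 0)
    (ray : Set ℂ) (hray : ray = {z : ℂ | ∃ s : ℝ, 0 ≤ s ∧ z = p + (s : ℂ) * v})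
    (hL : AnalyticOnNhd ℂ L (Metric.ball p r \ ray))
    (hL' : ∀ z ∈ Metric.ball p r \ ray, HasDerivAt L (1 / (z - p)) z)
    (yn : ℂ → ℂ) (hyn : ∀ z ∈ Metric.ball p r \ ray, yn z = f z + g z * L z) :
    ∃ F : ℂ → ℂ, AnalyticOnNhd ℂ F (Metric.ball p r) ∧
      ∀ z ∈ Metric.ball p r \ ray,
        F z = (z - p) ^ (n - 2) *
          (wronskian (Fin.snoc y yn) z - L z * wronskian (Fin.snoc y g) z) := by
  have hball : IsOpen (Metric.ball p r) := Metric.isOpen_ball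
  have hp : p ∈ Metric.ball p r := Metric.mem_ball_self hr
  have hS : IsOpen (Metric.ball p r \ ray) :=
    hball.sdiff (hray ▸ isClosed_complex_ray p v hv)
  have hpS : p ∉ Metric.ball p r \ ray := fun h =>
    h.2 (hray ▸ ⟨0, le_rfl, by simp⟩)
  have hid : AnalyticOnNhd ℂ (fun z => z - p) (Metric.ball p r) :=
    analyticOnNhd_id.sub analyticOnNhd_const
  have key : ∀ k : Fin (n - 1 + 1), ∃ h : ℂ → ℂ, AnalyticOnNhd ℂ h (Metric.ball p r) ∧
      ∀ z ∈ Metric.ball p r \ ray, h z = (z - p) ^ (n - 2) *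
        (iteratedDeriv (k : ℕ) yn z - L z * iteratedDeriv (k : ℕ) g z) := by
    rintro ⟨k, hk⟩
    rcases k with _ | k
    · refine ⟨fun z => (z - p) ^ (n - 2) * f z, (hid.pow _).mul hf, fun z hz => ?_⟩
      simp only [iteratedDeriv_zero, hyn z hz]
      ring
    · obtain ⟨h, hh, hhk⟩ := iteratedDeriv_succ_add_mul_log hball hS Set.sdiff_subset hp hpS
        hf hg hg0 hL' hyn k
      refine ⟨fun z => (z - p) ^ (n - 2 - k) * h z, (hid.pow _).mul hh, fun z hz => ?_⟩
      have h0 : z - p ≠ 0 := sub_ne_zero.2 fun h => hpS (h ▸ hz)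
      have hsplit : (z - p) ^ (n - 2) = (z - p) ^ (n - 2 - k) * (z - p) ^ k := by
        rw [← pow_add]
        congr 1
        omega
      simp only [hhk z hz, hsplit]
      field_simp
      ring
  choose H hH hHk using key
  refine ⟨fun z => (Matrix.updateCol
        (Matrix.of fun k j : Fin (n - 1 + 1) =>
          iteratedDeriv (k : ℕ) (Fin.snoc (α := fun _ => ℂ → ℂ) y 0 j) z)
        (Fin.last (n - 1)) fun k => H k z).det, ?_, fun z hz => ?_⟩
  · refine AnalyticOnNhd.matrix_det fun i j => ?_
    refine Fin.lastCases ?_ (fun j => ?_) j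
    · simpa using hH i
    · simp only [Matrix.updateCol_apply, Fin.castSucc_ne_last, if_false, Matrix.of_apply,
        Fin.snoc_castSucc]
      rw [iteratedDeriv_eq_iterate]
      exact (hy j).iterated_deriv _
  · have hcol : (fun k => H k z) = (z - p) ^ (n - 2) •
        ((fun k : Fin (n - 1 + 1) => iteratedDeriv (k : ℕ) yn z) +
          (-L z) • fun k : Fin (n - 1 + 1) => iteratedDeriv (k : ℕ) g z) := by
      ext k
      simp only [hHk k z hz, Pi.smul_apply, Pi.add_apply, smul_eq_mul]
      ring
    rw [wronskian_snoc, wronskian_snoc]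
    simp only [hcol, Matrix.det_updateCol_smul, Matrix.det_updateCol_add]
    ring
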